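/- Let n ≥ 1, R > 0, c > 0 and 4-n < a ≤ n-c. Then for every complex-valued function f ∈ C_0^∞(B(0,R)\{0}) one has ((n+a-4)c/4)² · ∫_{B(0,R)} |f(x)|² / (|x|^a (1-(|x|/R)^c)²) dx ≤ ∫_{B(0,R)} |𝓡²f(x) + ((n-1)/|x|)·𝓡f(x)|² / |x|^{a-4} dx. -/

import Mathlib

open MeasureTheory Metric

/-- The radial derivative `𝓡f(x) = Df(x)[x/|x|]` of a complex-valued function on `ℝⁿ`. -/
noncomputable def radDeriv {n : ℕ} (f : EuclideanSpace ℝ (Fin n) → ℂ)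
    (x : EuclideanSpace ℝ (Fin n)) : ℂ :=
  fderiv ℝ f x (‖x‖⁻¹ • x)

/-- Integration by parts against the Euler vector field `x ↦ x`. -/
lemma integral_fderiv_apply_self {n : ℕ} {F : EuclideanSpace ℝ (Fin n) → ℝ}
    (hF : ContDiff ℝ 1 F) (hc : HasCompactSupport F) :
    Integrable (fun x ↦ n * F x + fderiv ℝ F x x) ∧ ∫ x, (n * F x + fderiv ℝ F x x) = 0 := by
  set b := EuclideanSpace.basisFun (Fin n) ℝ
  have hcont : Continuous (fderiv ℝ F) := hF.continuous_fderiv one_ne_zero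
  have hcd : ∀ i : Fin n, ContDiff ℝ 1 (fun x : EuclideanSpace ℝ (Fin n) ↦ x i) := fun i ↦ by
    fun_prop
  have hiF : Integrable F := hF.continuous.integrable_of_hasCompactSupport hc
  have hfd : ∀ (i : Fin n) (x : EuclideanSpace ℝ (Fin n)),
      fderiv ℝ (fun y : EuclideanSpace ℝ (Fin n) ↦ y i) x (b i) = 1 := fun i x ↦ by
    have : (fun y : EuclideanSpace ℝ (Fin n) ↦ y i) =
        (EuclideanSpace.proj i : EuclideanSpace ℝ (Fin n) →L[ℝ] ℝ) := rfl
    rw [this, ContinuousLinearMap.fderiv]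
    simp [b]
  have hid : ∀ i : Fin n, Integrable
      (fun x : EuclideanSpace ℝ (Fin n) ↦ x i * fderiv ℝ F x (b i)) := fun i ↦ by
    refine Continuous.integrable_of_hasCompactSupport (by fun_prop) ?_
    exact (hc.fderiv_apply ℝ (b i)).mul_left
  have hparts : ∀ i : Fin n,
      ∫ x : EuclideanSpace ℝ (Fin n), x i * fderiv ℝ F x (b i) = - ∫ x, F x := fun i ↦ by
    rw [integral_mul_fderiv_eq_neg_fderiv_mul_of_integrable]
    · simp only [hfd, one_mul]
    · simpa only [hfd, one_mul] using hiF
    · exact hid i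
    · exact Continuous.integrable_of_hasCompactSupport (by fun_prop) hc.mul_left
    · exact fun x _ ↦ (hcd i).differentiable one_ne_zero x
    · exact fun x _ ↦ hF.differentiable one_ne_zero x
  have hsum : ∀ x, fderiv ℝ F x x = ∑ i, x i * fderiv ℝ F x (b i) := fun x ↦ by
    conv_lhs => arg 2; rw [← b.sum_repr x]
    rw [map_sum]
    simp [b]
  simp only [hsum]
  have hint : Integrable (fun x : EuclideanSpace ℝ (Fin n) ↦ ∑ i, x i * fderiv ℝ F x (b i)) :=
    integrable_finsetSum _ fun i _ ↦ hid i
  refine ⟨(hiF.const_mul _).add hint, ?_⟩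
  rw [integral_add (hiF.const_mul _) hint, integral_const_mul,
    integral_finsetSum _ fun i _ ↦ hid i]
  simp [hparts]

lemma fderiv_apply_self_eq_norm_smul_radDeriv {n : ℕ} (f : EuclideanSpace ℝ (Fin n) → ℂ)
    {x : EuclideanSpace ℝ (Fin n)} (hx : x ≠ 0) :
    fderiv ℝ f x x = ‖x‖ • radDeriv f x := by
  rw [radDeriv, map_smul, smul_smul, mul_inv_cancel₀ (norm_ne_zero_iff.2 hx), one_smul]

lemma tsupport_radDeriv_subset {n : ℕ} (f : EuclideanSpace ℝ (Fin n) → ℂ) :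
    tsupport (radDeriv f) ⊆ tsupport f := by
  refine closure_minimal (fun x hx ↦ ?_) (isClosed_tsupport f)
  refine support_fderiv_subset ℝ fun h ↦ hx ?_
  simp [radDeriv, h]

lemma contDiff_of_contDiffAt_tsupport {E F : Type*} [NormedAddCommGroup E] [NormedSpace ℝ E]
    [NormedAddCommGroup F] [NormedSpace ℝ F] {k : WithTop ℕ∞} {f : E → F}
    (hf : ∀ x ∈ tsupport f, ContDiffAt ℝ k f x) : ContDiff ℝ k f :=
  contDiff_iff_contDiffAt.2 fun x ↦ (em _).elim (hf x) fun hx ↦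
    (contDiffAt_const (c := 0)).congr_of_eventuallyEq (notMem_tsupport_iff_eventuallyEq.1 hx)

lemma contDiff_radDeriv {n : ℕ} {f : EuclideanSpace ℝ (Fin n) → ℂ}
    (hf : ContDiff ℝ (⊤ : ℕ∞) f) (h0 : 0 ∉ tsupport f) :
    ContDiff ℝ (⊤ : ℕ∞) (radDeriv f) := by
  refine contDiff_of_contDiffAt_tsupport fun x hx ↦ ?_
  have hx0 : x ≠ 0 := fun h ↦ h0 (h ▸ tsupport_radDeriv_subset f hx)
  have h1 : ContDiff ℝ (⊤ : ℕ∞) (fderiv ℝ f) := hf.fderiv_right (by simp)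
  exact h1.contDiffAt.clm_apply
    (((contDiffAt_norm ℝ hx0).inv (norm_ne_zero_iff.2 hx0)).smul contDiffAt_id)

lemma fderiv_norm_apply_self {E : Type*} [NormedAddCommGroup E] [InnerProductSpace ℝ E]
    {x : E} (hx : x ≠ 0) : fderiv ℝ (fun y : E ↦ ‖y‖) x x = ‖x‖ := by
  have h := ((contDiffAt_norm ℝ hx (n := 1)).differentiableAt one_ne_zero).hasFDerivAt.pow 2
  have h2 := congrArg (fun L ↦ L x) (h.unique (hasStrictFDerivAt_norm_sq x).hasFDerivAt)
  simp at h2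
  have hx' := norm_ne_zero_iff.2 hx
  have : ‖x‖ * (fderiv ℝ (fun y : E ↦ ‖y‖) x x - ‖x‖) = 0 := by nlinarith
  linarith [(mul_eq_zero.1 this).resolve_left hx']

/-- The divergence identity for the vector field `x ↦ φ(|x|) |g(x)|² x`, where `ψ(r)` is `r` times the
derivative of `φ`. -/
lemma integral_radial_weight_mul_norm_sq {n : ℕ} {R : ℝ} {g : EuclideanSpace ℝ (Fin n) → ℂ}
    (hg : ContDiff ℝ (⊤ : ℕ∞) g) (hcomp : HasCompactSupport g)
    (hsupp : tsupport g ⊆ ball (0 : EuclideanSpace ℝ (Fin n)) R \ {0}) {φ ψ : ℝ → ℝ}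
    (hφ : ∀ r ∈ Set.Ioo 0 R, ContDiffAt ℝ 1 φ r)
    (hψ : ∀ r ∈ Set.Ioo 0 R, HasDerivAt φ (ψ r / r) r) :
    Integrable (fun x ↦ ‖g x‖ ^ 2 * (n * φ ‖x‖ + ψ ‖x‖) +
      2 * ‖x‖ * φ ‖x‖ * inner ℝ (g x) (radDeriv g x)) ∧
    ∫ x, (‖g x‖ ^ 2 * (n * φ ‖x‖ + ψ ‖x‖) +
      2 * ‖x‖ * φ ‖x‖ * inner ℝ (g x) (radDeriv g x)) = 0 := by
  set F : EuclideanSpace ℝ (Fin n) → ℝ := fun x ↦ φ ‖x‖ * ‖g x‖ ^ 2 with hFdef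
  have hsub : tsupport F ⊆ tsupport g := by
    refine closure_mono fun x hx h ↦ hx ?_
    simp [hFdef, h]
  have hx0 : ∀ x ∈ tsupport g, x ≠ 0 ∧ ‖x‖ ∈ Set.Ioo 0 R := fun x hx ↦ by
    have h := hsupp hx
    have h0 : x ≠ 0 := h.2
    exact ⟨h0, norm_pos_iff.2 h0, by simpa using h.1⟩
  have hF : ContDiff ℝ 1 F := by
    refine contDiff_of_contDiffAt_tsupport fun x hx ↦ ?_
    obtain ⟨h0, hr⟩ := hx0 x (hsub hx)
    have hg1 : ContDiff ℝ 1 g := hg.of_le (by exact_mod_cast le_top)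
    exact ((hφ _ hr).comp x (contDiffAt_norm ℝ h0)).mul (hg1.contDiffAt.norm_sq ℝ)
  have hFc : HasCompactSupport F := hcomp.of_isClosed_subset (isClosed_tsupport F) hsub
  have key : (fun x ↦ n * F x + fderiv ℝ F x x) = fun x ↦ ‖g x‖ ^ 2 * (n * φ ‖x‖ + ψ ‖x‖) +
      2 * ‖x‖ * φ ‖x‖ * inner ℝ (g x) (radDeriv g x) := by
    funext x
    by_cases hx : x ∈ tsupport g
    · obtain ⟨h0, hr⟩ := hx0 x hx
      have h1 := (hψ _ hr).comp_hasFDerivAt x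
        ((contDiffAt_norm ℝ h0 (n := 1)).differentiableAt one_ne_zero).hasFDerivAt
      have h2 := ((hg.differentiable (by simp)) x).hasFDerivAt.norm_sq
      have h3 := (h1.mul h2).fderiv
      have h4 : fderiv ℝ F x = _ := h3
      have hr0 := hr.1.ne'
      rw [h4]
      simp [fderiv_norm_apply_self h0, fderiv_apply_self_eq_norm_smul_radDeriv g h0,
        hFdef]
      field_simp
      ring
    · have e1 : g x = 0 := image_eq_zero_of_notMem_tsupport hx
      have e2 : fderiv ℝ F x = 0 :=
        image_eq_zero_of_notMem_tsupport fun h ↦ hx (hsub (tsupport_fderiv_subset ℝ h))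
      rw [e2]
      simp [hFdef, e1]
  rw [← key]
  exact integral_fderiv_apply_self hF hFc

/-- The pointwise inequality behind the Hardy–Rellich step; `u` and `v` stand for the first and
second radial derivatives. -/
lemma rellich_pointwise (u v : ℂ) {ρ : ℝ} (hρ : 0 < ρ) (N a : ℝ) :
    ((N + a - 4) / 2) ^ 2 * ρ ^ 2 * ‖u‖ ^ 2 ≤
      ρ ^ 4 * ‖v + (((N - 1) / ρ : ℝ) : ℂ) * u‖ ^ 2 + (4 - a - N) / 2 *
        (‖u‖ ^ 2 * (N * ρ ^ 2 + (2 - a) * ρ ^ 2) + 2 * ρ * ρ ^ 2 * inner ℝ u v) := by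
  have h := sq_nonneg ‖(ρ ^ 2) • (v + ((N - 1) / ρ) • u) + ((4 - a - N) / 2 * ρ) • u‖
  rw [← Complex.real_smul]
  rw [norm_add_sq_real] at h
  simp only [norm_smul, mul_pow, Real.norm_eq_abs, sq_abs, real_inner_smul_left,
    real_inner_smul_right, inner_add_left, real_inner_self_eq_norm_sq] at h
  rw [real_inner_comm u v] at h
  have e3 : (N - 1) / ρ * ρ ^ 3 = (N - 1) * ρ ^ 2 := by field_simp
  linear_combination h + (4 - a - N) * ‖u‖ ^ 2 * e3

/-- The pointwise inequality behind the improved Hardy step, with `d = 1 - (ρ/R)^c`. -/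
lemma hardy_pointwise (w u : ℂ) {ρ d N a c : ℝ} (hd : 0 < d) (hc : 0 < c) (ha : a ≤ N - c) :
    (c / 2) ^ 2 * (‖w‖ ^ 2 / d ^ 2) ≤ ρ ^ 2 * ‖u‖ ^ 2 +
      (‖w‖ ^ 2 * (N * (c / 2 / d) + c / 2 * (-a / d + c * (1 - d) / d ^ 2)) +
        2 * ρ * (c / 2 / d) * inner ℝ w u) := by
  have h := sq_nonneg ‖ρ • u + (c / 2 / d) • w‖
  rw [norm_add_sq_real] at h
  simp only [norm_smul, mul_pow, Real.norm_eq_abs, sq_abs, real_inner_smul_left,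
    real_inner_smul_right] at h
  rw [real_inner_comm w u] at h
  have h2 : 0 ≤ c / 2 * ‖w‖ ^ 2 * (N - a - c) / d :=
    div_nonneg (mul_nonneg (by positivity) (by linarith)) hd.le
  have e : (c / 2) ^ 2 * (‖w‖ ^ 2 / d ^ 2) + (c / 2 / d) ^ 2 * ‖w‖ ^ 2 +
      c / 2 * ‖w‖ ^ 2 * (N - a - c) / d =
      ‖w‖ ^ 2 * (N * (c / 2 / d) + c / 2 * (-a / d + c * (1 - d) / d ^ 2)) := by
    field_simp
    ring
  linarith

theorem unified_L2_rellich_inequality {n : ℕ} (hn : 1 ≤ n) {R : ℝ} (hR : 0 < R)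
    {a c : ℝ} (hc : 0 < c) (ha1 : 4 - (n : ℝ) < a) (ha2 : a ≤ (n : ℝ) - c)
    (f : EuclideanSpace ℝ (Fin n) → ℂ)
    (hf : ContDiff ℝ (⊤ : ℕ∞) f) (hcomp : HasCompactSupport f)
    (hsupp : tsupport f ⊆ ball (0 : EuclideanSpace ℝ (Fin n)) R \ {0}) :
    (((n : ℝ) + a - 4) * c / 4) ^ 2 *
      (∫ x in ball (0 : EuclideanSpace ℝ (Fin n)) R,
        ‖f x‖ ^ 2 / (‖x‖ ^ a * (1 - (‖x‖ / R) ^ c) ^ 2)) ≤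
    ∫ x in ball (0 : EuclideanSpace ℝ (Fin n)) R,
        ‖radDeriv (radDeriv f) x + ((((n : ℝ) - 1) / ‖x‖ : ℝ) : ℂ) * radDeriv f x‖ ^ 2 /
          ‖x‖ ^ (a - 4) := by
  set γ : ℝ := 4 - a - n
  set g := radDeriv f
  have h0 : (0 : EuclideanSpace ℝ (Fin n)) ∉ tsupport f := fun h ↦ (hsupp h).2 rfl
  have hg : ContDiff ℝ (⊤ : ℕ∞) g := contDiff_radDeriv hf h0
  have hgs : tsupport g ⊆ tsupport f := tsupport_radDeriv_subset f
  have hgc : HasCompactSupport g := hcomp.of_isClosed_subset (isClosed_tsupport g) hgs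
  have hg2 : ContDiff ℝ (⊤ : ℕ∞) (radDeriv g) := contDiff_radDeriv hg fun h ↦ h0 (hgs h)
  have hg2s : tsupport (radDeriv g) ⊆ tsupport f := (tsupport_radDeriv_subset g).trans hgs
  have hx0 : ∀ x ∈ tsupport f, x ≠ 0 ∧ 0 < ‖x‖ ∧ ‖x‖ < R := fun x hx ↦ by
    have h := hsupp hx
    have h0 : x ≠ 0 := h.2
    exact ⟨h0, norm_pos_iff.2 h0, by simpa using h.1⟩
  have hf0 : ∀ x ∉ tsupport f, f x = 0 ∧ g x = 0 ∧ radDeriv g x = 0 := fun x hx ↦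
    ⟨image_eq_zero_of_notMem_tsupport hx,
      image_eq_zero_of_notMem_tsupport fun h ↦ hx (hgs h),
      image_eq_zero_of_notMem_tsupport fun h ↦ hx (hg2s h)⟩
  have ht : ∀ r : ℝ, 0 < r → r < R → 0 < 1 - (r / R) ^ c := fun r h1 h2 ↦ by
    have := Real.rpow_lt_one (div_pos h1 hR).le ((div_lt_one hR).2 h2) hc
    linarith
  have hball : ∀ x : EuclideanSpace ℝ (Fin n), x ∉ ball 0 R → x ∉ tsupport f :=
    fun x hx h ↦ hx (hsupp h).1
  rw [setIntegral_eq_integral_of_forall_compl_eq_zero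
      (fun x hx ↦ by simp [hf0 x (hball x hx)]),
    setIntegral_eq_integral_of_forall_compl_eq_zero
      (fun x hx ↦ by simp [hf0 x (hball x hx)]), ← integral_const_mul]
  set P : EuclideanSpace ℝ (Fin n) → ℝ := fun x ↦
    ‖radDeriv g x + ((((n : ℝ) - 1) / ‖x‖ : ℝ) : ℂ) * g x‖ ^ 2 / ‖x‖ ^ (a - 4) with hP
  have hPs : tsupport P ⊆ tsupport f := by
    refine closure_minimal (fun x hx ↦ ?_) (isClosed_tsupport f)
    by_contra h
    exact hx (by simp [hP, hf0 x h])
  have hPi : Integrable P := by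
    refine Continuous.integrable_of_hasCompactSupport (continuous_of_tsupport fun x hx ↦ ?_)
      (hcomp.of_isClosed_subset (isClosed_tsupport P) hPs)
    obtain ⟨hx1, hx2, -⟩ := hx0 x (hPs hx)
    have c1 : ContinuousAt (fun x : EuclideanSpace ℝ (Fin n) ↦ ‖x‖) x := continuous_norm.continuousAt
    have c2 := (hg2.continuous.continuousAt (x := x)).add
      ((Complex.continuous_ofReal.continuousAt.comp
        ((continuousAt_const (y := (n : ℝ) - 1)).div c1 hx2.ne')).mul hg.continuous.continuousAt)
    exact (c2.norm.pow 2).div (c1.rpow_const (Or.inl hx2.ne')) (Real.rpow_pos_of_pos hx2 _).ne'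
  obtain ⟨hI1, hZ1⟩ := integral_radial_weight_mul_norm_sq (R := R)
    (φ := fun r ↦ r ^ (2 - a)) (ψ := fun r ↦ (2 - a) * r ^ (2 - a)) hg hgc (hgs.trans hsupp)
    (fun r hr ↦ contDiffAt_id.rpow_const_of_ne hr.1.ne')
    (fun r hr ↦ by
      convert Real.hasDerivAt_rpow_const (p := 2 - a) (Or.inl hr.1.ne') using 1
      rw [Real.rpow_sub_one hr.1.ne', mul_div_assoc])
  obtain ⟨hI2, hZ2⟩ := integral_radial_weight_mul_norm_sq (R := R)
    (φ := fun r ↦ c / 2 * (r ^ (-a) / (1 - (r / R) ^ c)))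
    (ψ := fun r ↦ c / 2 * (-a * r ^ (-a) / (1 - (r / R) ^ c) +
      c * (r / R) ^ c * r ^ (-a) / (1 - (r / R) ^ c) ^ 2)) hf hcomp hsupp
    (fun r hr ↦ contDiffAt_const.mul ((contDiffAt_id.rpow_const_of_ne hr.1.ne').div
      (contDiffAt_const.sub ((contDiffAt_id.div_const R).rpow_const_of_ne
        (div_pos hr.1 hR).ne')) (ht r hr.1 hr.2).ne'))
    (fun r hr ↦ by
      have hr0 := hr.1.ne'
      have hd := (ht r hr.1 hr.2).ne'
      have d1 := Real.hasDerivAt_rpow_const (p := -a) (Or.inl hr0)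
      have d2 := ((hasDerivAt_id r).div_const R).rpow_const (p := c)
        (Or.inl (div_pos hr.1 hR).ne')
      have d3 := (d1.div (d2.const_sub 1) hd).const_mul (c / 2)
      refine d3.congr_deriv ?_
      simp only [id]
      rw [Real.rpow_sub_one hr0, Real.rpow_sub_one (div_pos hr.1 hR).ne']
      generalize (r / R) ^ c = t at hd
      field_simp
      ring)
  have hle := integral_mono_of_nonneg (μ := volume) (f := fun x ↦ (((n : ℝ) + a - 4) * c / 4) ^ 2 *
      (‖f x‖ ^ 2 / (‖x‖ ^ a * (1 - (‖x‖ / R) ^ c) ^ 2)))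
    (ae_of_all _ fun x ↦ by dsimp; positivity)
    ((hPi.add (hI1.const_mul (γ / 2))).add (hI2.const_mul ((((n : ℝ) + a - 4) / 2) ^ 2)))
    (ae_of_all _ fun x ↦ ?_)
  · refine hle.trans_eq ?_
    rw [integral_add' (hPi.add (hI1.const_mul _)) (hI2.const_mul _),
      integral_add' hPi (hI1.const_mul _), integral_const_mul, integral_const_mul, hZ1, hZ2]
    simp
  · simp only [Pi.add_apply]
    by_cases hx : x ∈ tsupport f
    · obtain ⟨hx1, hρ, hρR⟩ := hx0 x hx
      have hd := ht _ hρ hρR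
      have r1 := rellich_pointwise (g x) (radDeriv g x) hρ n a
      have r2 := hardy_pointwise (f x) (g x) (ρ := ‖x‖) hd hc ha2
      have hX : 0 < ‖x‖ ^ (-a) := Real.rpow_pos_of_pos hρ _
      have e1 : ‖x‖ ^ a = (‖x‖ ^ (-a))⁻¹ := by rw [Real.rpow_neg hρ.le, inv_inv]
      have e2 : ‖x‖ ^ (2 - a) = ‖x‖ ^ (-a) * ‖x‖ ^ 2 := by
        rw [sub_eq_neg_add, Real.rpow_add hρ]; norm_cast
      have e3 : ‖x‖ ^ (a - 4) = (‖x‖ ^ (-a) * ‖x‖ ^ 4)⁻¹ := by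
        rw [← neg_sub, Real.rpow_neg hρ.le, sub_eq_neg_add, Real.rpow_add hρ]; norm_cast
      simp only [hP, e1, e2, e3, div_inv_eq_mul]
      have r3 := mul_le_mul_of_nonneg_left
        (add_le_add r1 (mul_le_mul_of_nonneg_left r2 (sq_nonneg (((n : ℝ) + a - 4) / 2)))) hX.le
      generalize ‖x‖ ^ (-a) = X at *
      generalize (‖x‖ / R) ^ c = t at *
      have e4 : ‖f x‖ ^ 2 / (X⁻¹ * (1 - t) ^ 2) = X * (‖f x‖ ^ 2 / (1 - t) ^ 2) := by
        field_simp
      rw [e4]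
      simp only [sub_sub_cancel] at r3
      linear_combination r3
    · simp [hP, hf0 x hx]
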